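/- Let y ∈ ℝ^{I₁I₂N}, X ∈ ℝ^{N×p}, and let Σ₁, Σ₂, Σ₃ be symmetric positive definite with XᵀΣ₃⁻¹X invertible. Suppose U⁽¹⁾ ∈ ℝ^{I₁×P₁} and U⁽²⁾ ∈ ℝ^{I₂×P₂} satisfy the weighted orthonormality constraints U⁽¹⁾ᵀΣ₁⁻¹U⁽¹⁾ = I_{P₁} and U⁽²⁾ᵀΣ₂⁻¹U⁽²⁾ = I_{P₂}. Then the minimizer given by Proposition 1 simplifies to β* = ((XᵀΣ₃⁻¹X)⁻¹XᵀΣ₃⁻¹ ⊗ U⁽²⁾ᵀΣ₂⁻¹ ⊗ U⁽¹⁾ᵀΣ₁⁻¹) y, and β* minimizes l(β) = (y − (X ⊗ U⁽²⁾ ⊗ U⁽¹⁾)β)ᵀ (Σ₃ ⊗ Σ₂ ⊗ Σ₁)⁻¹ (y − (X ⊗ U⁽²⁾ ⊗ U⁽¹⁾)β) over β ∈ ℝ^{P₁P₂p}. -/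

import Mathlib

open Matrix
open scoped Kronecker

/-- The generalized least squares objective with basis matrices `U¹, U²`. -/
noncomputable def glsObj {I₁ I₂ N p P₁ P₂ : ℕ}
    (X : Matrix (Fin N) (Fin p) ℝ)
    (U₁ : Matrix (Fin I₁) (Fin P₁) ℝ) (U₂ : Matrix (Fin I₂) (Fin P₂) ℝ)
    (S₁ : Matrix (Fin I₁) (Fin I₁) ℝ) (S₂ : Matrix (Fin I₂) (Fin I₂) ℝ)
    (S₃ : Matrix (Fin N) (Fin N) ℝ)
    (y : Matrix (Fin N × Fin I₂ × Fin I₁) (Fin 1) ℝ)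
    (β : Matrix (Fin p × Fin P₂ × Fin P₁) (Fin 1) ℝ) : ℝ :=
  ((y - (X ⊗ₖ (U₂ ⊗ₖ U₁)) * β)ᵀ * (S₃ ⊗ₖ (S₂ ⊗ₖ S₁))⁻¹ *
      (y - (X ⊗ₖ (U₂ ⊗ₖ U₁)) * β)) 0 0

lemma gls_aux {m k : Type*} [Fintype m] [Fintype k] (A : Matrix m k ℝ) (W : Matrix m m ℝ)
    (hW : W.PosSemidef) (y : Matrix m (Fin 1) ℝ) (b β : Matrix k (Fin 1) ℝ)
    (h : Aᵀ * W * (y - A * b) = 0) :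
    ((y - A * b)ᵀ * W * (y - A * b)) 0 0 ≤ ((y - A * β)ᵀ * W * (y - A * β)) 0 0 := by
  have hWt : Wᵀ = W := by simpa using hW.isHermitian.eq
  have e : y - A * β = (y - A * b) + A * (b - β) := by
    rw [Matrix.mul_sub]; abel
  rw [e]
  generalize y - A * b = r at *
  generalize b - β = d at *
  have h1 : (A * d)ᵀ * W * r = 0 := by
    rw [transpose_mul, Matrix.mul_assoc, Matrix.mul_assoc, ← Matrix.mul_assoc Aᵀ, h,
      Matrix.mul_zero]
  have h2 : rᵀ * W * (A * d) = 0 := by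
    have := congrArg transpose h1
    simpa [transpose_mul, hWt, Matrix.mul_assoc] using this
  have h3 : 0 ≤ ((A * d)ᵀ * W * (A * d)) 0 0 := by
    have := (hW.conjTranspose_mul_mul_same (A * d)).diag_nonneg (i := 0)
    simpa using this
  have h4 : (r + A * d)ᵀ * W * (r + A * d) = rᵀ * W * r + (A * d)ᵀ * W * (A * d) := by
    rw [transpose_add, Matrix.add_mul, Matrix.add_mul, Matrix.mul_add, Matrix.mul_add, h1, h2]
    simp
  rw [h4, Matrix.add_apply]
  linarith

/-- under the weighted orthonormality constraints
`U¹ᵀΣ₁⁻¹U¹ = I` and `U²ᵀΣ₂⁻¹U² = I`, the minimizer of Proposition 1 simplifies to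
`β* = ((XᵀΣ₃⁻¹X)⁻¹XᵀΣ₃⁻¹ ⊗ U²ᵀΣ₂⁻¹ ⊗ U¹ᵀΣ₁⁻¹) y`, and `β*` minimizes the objective. -/
theorem stmt_5 (I₁ I₂ N p P₁ P₂ : ℕ)
    (y : Matrix (Fin N × Fin I₂ × Fin I₁) (Fin 1) ℝ)
    (X : Matrix (Fin N) (Fin p) ℝ)
    (U₁ : Matrix (Fin I₁) (Fin P₁) ℝ) (U₂ : Matrix (Fin I₂) (Fin P₂) ℝ)
    (S₁ : Matrix (Fin I₁) (Fin I₁) ℝ) (S₂ : Matrix (Fin I₂) (Fin I₂) ℝ)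
    (S₃ : Matrix (Fin N) (Fin N) ℝ)
    (hS₁ : S₁.PosDef) (hS₂ : S₂.PosDef) (hS₃ : S₃.PosDef)
    (hX : IsUnit (Xᵀ * S₃⁻¹ * X))
    (hU₁ : U₁ᵀ * S₁⁻¹ * U₁ = 1) (hU₂ : U₂ᵀ * S₂⁻¹ * U₂ = 1) :
    ((((Xᵀ * S₃⁻¹ * X)⁻¹ * Xᵀ * S₃⁻¹) ⊗ₖ
        (((U₂ᵀ * S₂⁻¹ * U₂)⁻¹ * U₂ᵀ * S₂⁻¹) ⊗ₖ ((U₁ᵀ * S₁⁻¹ * U₁)⁻¹ * U₁ᵀ * S₁⁻¹))) * y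
        = (((Xᵀ * S₃⁻¹ * X)⁻¹ * Xᵀ * S₃⁻¹) ⊗ₖ ((U₂ᵀ * S₂⁻¹) ⊗ₖ (U₁ᵀ * S₁⁻¹))) * y) ∧
      ∀ β : Matrix (Fin p × Fin P₂ × Fin P₁) (Fin 1) ℝ,
        glsObj X U₁ U₂ S₁ S₂ S₃ y
            ((((Xᵀ * S₃⁻¹ * X)⁻¹ * Xᵀ * S₃⁻¹) ⊗ₖ ((U₂ᵀ * S₂⁻¹) ⊗ₖ (U₁ᵀ * S₁⁻¹))) * y)
          ≤ glsObj X U₁ U₂ S₁ S₂ S₃ y β := by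
  refine ⟨by rw [hU₁, hU₂]; simp, fun β => ?_⟩
  unfold glsObj
  apply gls_aux
  · exact (hS₃.kronecker (hS₂.kronecker hS₁)).inv.posSemidef
  · rw [Matrix.mul_sub, ← Matrix.mul_assoc, ← Matrix.mul_assoc, ← Matrix.sub_mul]
    rw [inv_kronecker, inv_kronecker, ← kroneckerMap_transpose, ← kroneckerMap_transpose]
    simp only [← mul_kronecker_mul]
    rw [hU₁, hU₂, Matrix.one_mul, Matrix.one_mul]
    have : Xᵀ * S₃⁻¹ * X * ((Xᵀ * S₃⁻¹ * X)⁻¹ * Xᵀ * S₃⁻¹) = Xᵀ * S₃⁻¹ := by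
      rw [← Matrix.mul_assoc, ← Matrix.mul_assoc,
        Matrix.mul_nonsing_inv _ ((Matrix.isUnit_iff_isUnit_det _).1 hX), Matrix.one_mul]
    rw [this, sub_self, Matrix.zero_mul]
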